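/- Let σ : [0,1]² → ℝ⁴ be a smooth injective map whose differential Dσ(s,t) is injective at every point. For each pair 0 ≤ a < b ≤ 3 let (c,d) be the complementary pair with {a,b,c,d} = {0,1,2,3}. Then lim_{κ→∞} Σ_{0≤a<b≤3} (κ²/4) ∫_{[0,1]²×[0,1]²} e^{−κ²|σ(s,t)−σ(s̄,t̄)|²/8} · |det J_ab(s,t)| · |det J_ab(s̄,t̄)| ds dt ds̄ dt̄ = 2π · Σ_{0≤a<b≤3} ∫_{[0,1]²} (det J_ab(s,t))² / √(det(J_ab(s,t)ᵀ J_ab(s,t) + J_cd(s,t)ᵀ J_cd(s,t))) ds dt, and this limit (denoted 2π∫_S ρ_S) is independent of the parametrization σ of the surface S = σ([0,1]²). -/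

import Mathlib

open MeasureTheory Real Filter Matrix

/-- The `2×2` Jacobian matrix `J_ab(s,t)` of a map `σ : ℝ² → ℝ⁴`, with rows
`(∂ₛσ_a, ∂ₜσ_a)` and `(∂ₛσ_b, ∂ₜσ_b)`. -/
noncomputable def Jmat (σ : ℝ × ℝ → Fin 4 → ℝ) (a b : Fin 4) (q : ℝ × ℝ) :
    Matrix (Fin 2) (Fin 2) ℝ :=
  !![fderiv ℝ σ q ((1 : ℝ), (0 : ℝ)) a, fderiv ℝ σ q ((0 : ℝ), (1 : ℝ)) a;
     fderiv ℝ σ q ((1 : ℝ), (0 : ℝ)) b, fderiv ℝ σ q ((0 : ℝ), (1 : ℝ)) b]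

/-- The unit square `[0,1]² ⊆ ℝ²`. -/
def Isq : Set (ℝ × ℝ) := Set.Icc (0 : ℝ) 1 ×ˢ Set.Icc (0 : ℝ) 1

/-- The six quadruples `(a,b,c,d)` with `0 ≤ a < b ≤ 3` and `(c,d)` the complementary pair
(`c < d`, `{a,b,c,d} = {0,1,2,3}`). -/
def quads : List (Fin 4 × Fin 4 × Fin 4 × Fin 4) :=
  [(0, 1, 2, 3), (0, 2, 1, 3), (0, 3, 1, 2), (1, 2, 0, 3), (1, 3, 0, 2), (2, 3, 0, 1)]

/-- The double surface integral
`Σ_{0≤a<b≤3} (κ²/4) ∫_{I²×I²} e^{−κ²|σ(s,t)−σ(s̄,t̄)|²/8} |det J_ab(s,t)| |det J_ab(s̄,t̄)|`. -/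
noncomputable def doubleSum (σ : ℝ × ℝ → Fin 4 → ℝ) (κ : ℝ) : ℝ :=
  (quads.map fun q =>
    (κ ^ 2 / 4) * ∫ st in Isq, ∫ st' in Isq,
      Real.exp (-κ ^ 2 * (∑ i, (σ st i - σ st' i) ^ 2) / 8) *
        |(Jmat σ q.1 q.2.1 st).det| * |(Jmat σ q.1 q.2.1 st').det|).sum

/-- `∫_S ρ_S = Σ_{0≤a<b≤3} ∫_{I²} (det J_ab)² / √(det(J_abᵀJ_ab + J_cdᵀJ_cd))`. -/
noncomputable def rhoIntegral (σ : ℝ × ℝ → Fin 4 → ℝ) : ℝ :=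
  (quads.map fun q =>
    ∫ st in Isq, (Jmat σ q.1 q.2.1 st).det ^ 2 /
      Real.sqrt (((Jmat σ q.1 q.2.1 st)ᵀ * Jmat σ q.1 q.2.1 st +
        (Jmat σ q.2.2.1 q.2.2.2 st)ᵀ * Jmat σ q.2.2.1 q.2.2.2 st).det)).sum

lemma ContinuousLinearMap.exists_leftInverse_of_injective_pi {n : ℕ}
    (A : ℝ × ℝ →L[ℝ] (Fin n → ℝ)) (hA : Function.Injective A) :
    ∃ L : (Fin n → ℝ) →L[ℝ] ℝ × ℝ, L.comp A = ContinuousLinearMap.id ℝ (ℝ × ℝ) := by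
  obtain ⟨g, hg⟩ := LinearMap.exists_leftInverse_of_injective (A : ℝ × ℝ →ₗ[ℝ] (Fin n → ℝ))
    (LinearMap.ker_eq_bot.2 hA)
  refine ⟨LinearMap.toContinuousLinearMap g, ?_⟩
  ext1 <;> ext1 <;> exact DFunLike.congr_fun hg _

lemma isCompact_Isq : IsCompact Isq := isCompact_Icc.prod isCompact_Icc

lemma measurableSet_Isq : MeasurableSet Isq := isCompact_Isq.measurableSet

lemma Isq_ae_mem_interior : ∀ᵐ x ∂(volume.restrict Isq), Isq ∈ nhds x := by
  have h : Convex ℝ Isq := (convex_Icc 0 1).prod (convex_Icc 0 1)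
  have h0 : ∀ᵐ x ∂(volume : Measure (ℝ × ℝ)), x ∉ frontier Isq :=
    measure_eq_zero_iff_ae_notMem.1 (h.addHaar_frontier volume)
  filter_upwards [ae_restrict_of_ae h0, ae_restrict_mem measurableSet_Isq] with x hx hxI
  rw [← mem_interior_iff_mem_nhds]
  by_contra hc
  exact hx ⟨subset_closure hxI, hc⟩

lemma uniqueDiffOn_Isq : UniqueDiffOn ℝ Isq :=
  (uniqueDiffOn_Icc zero_lt_one).prod (uniqueDiffOn_Icc zero_lt_one)

/-- An injective immersion of a compact set is bi-Lipschitz onto its image. -/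
lemma exists_pos_mul_dist_le_of_injOn_immersion {σ : ℝ × ℝ → Fin 4 → ℝ} (hσ : ContDiff ℝ 1 σ)
    {K : Set (ℝ × ℝ)} (hK : IsCompact K) (hinj : Set.InjOn σ K)
    (himm : ∀ q ∈ K, Function.Injective (fderiv ℝ σ q)) :
    ∃ c > 0, ∀ x ∈ K, ∀ y ∈ K, c * ‖x - y‖ ≤ ‖σ x - σ y‖ := by
  have key : ∃ c > 0, ∀ z ∈ K ×ˢ K, c * ‖z.1 - z.2‖ ≤ ‖σ z.1 - σ z.2‖ := by
    refine (hK.prod hK).induction_on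
      (p := fun s => ∃ c > 0, ∀ z ∈ s, c * ‖z.1 - z.2‖ ≤ ‖σ z.1 - σ z.2‖)
      ⟨1, one_pos, by simp⟩ (fun s t hst ⟨c, hc, h⟩ => ⟨c, hc, fun z hz => h z (hst hz)⟩) ?_ ?_
    · rintro s t ⟨c, hc, h⟩ ⟨d, hd, h'⟩
      refine ⟨min c d, lt_min hc hd, ?_⟩
      rintro z (hz | hz)
      · exact (mul_le_mul_of_nonneg_right (min_le_left _ _) (norm_nonneg _)).trans (h z hz)
      · exact (mul_le_mul_of_nonneg_right (min_le_right _ _) (norm_nonneg _)).trans (h' z hz)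
    · rintro ⟨x, y⟩ ⟨hx, hy⟩
      suffices ∃ c > 0, ∀ᶠ z in nhds (x, y), c * ‖z.1 - z.2‖ ≤ ‖σ z.1 - σ z.2‖ by
        obtain ⟨c, hc, h⟩ := this
        exact ⟨_, mem_nhdsWithin_of_mem_nhds h, c, hc, fun z hz => hz⟩
      have hcont := hσ.continuous
      by_cases hxy : x = y
      · subst hxy
        obtain ⟨L, hL⟩ := (fderiv ℝ σ x).exists_leftInverse_of_injective_pi (himm x hx)
        have hs : HasStrictFDerivAt (fun z => L (σ z)) (ContinuousLinearMap.id ℝ (ℝ × ℝ)) x := by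
          rw [← hL]
          exact L.hasStrictFDerivAt.comp x (hσ.contDiffAt.hasStrictFDerivAt one_ne_zero)
        have hb := hs.isLittleO.def (c := 1 / 2) (by norm_num)
        refine ⟨1 / (2 * (‖L‖ + 1)), by positivity, ?_⟩
        filter_upwards [hb] with z hz
        have h1 : ‖z.1 - z.2‖ ≤ 1 / 2 * ‖z.1 - z.2‖ + ‖L (σ z.1) - L (σ z.2)‖ := by
          calc ‖z.1 - z.2‖ = ‖(L (σ z.1) - L (σ z.2)) - (L (σ z.1) - L (σ z.2) - (z.1 - z.2))‖ := by
                congr 1; abel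
            _ ≤ _ := (norm_sub_le _ _).trans (by
                rw [add_comm]; gcongr; simpa using hz)
        have h2 : ‖L (σ z.1) - L (σ z.2)‖ ≤ (‖L‖ + 1) * ‖σ z.1 - σ z.2‖ := by
          rw [← map_sub]
          exact (L.le_opNorm _).trans (by gcongr; linarith)
        rw [div_mul_eq_mul_div, one_mul, div_le_iff₀ (by positivity)]
        linarith
      · have hne : 0 < ‖σ x - σ y‖ := norm_pos_iff.2 (sub_ne_zero.2 fun h => hxy (hinj hx hy h))
        refine ⟨‖σ x - σ y‖ / (2 * (‖x - y‖ + 1)), by positivity, ?_⟩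
        have hlt : ‖σ x - σ y‖ / (2 * (‖x - y‖ + 1)) * ‖x - y‖ < ‖σ x - σ y‖ := by
          rw [div_mul_eq_mul_div, div_lt_iff₀ (by positivity)]
          nlinarith [norm_nonneg (x - y)]
        have hc1 : Continuous fun z : (ℝ × ℝ) × (ℝ × ℝ) =>
          ‖σ x - σ y‖ / (2 * (‖x - y‖ + 1)) * ‖z.1 - z.2‖ := by fun_prop
        have hc2 : Continuous fun z : (ℝ × ℝ) × (ℝ × ℝ) => ‖σ z.1 - σ z.2‖ := by fun_prop
        filter_upwards [(hc1.continuousAt (x := (x, y))).eventually_lt hc2.continuousAt hlt] with z hz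
        exact hz.le
  obtain ⟨c, hc, h⟩ := key
  exact ⟨c, hc, fun x hx y hy => h (x, y) ⟨hx, hy⟩⟩

lemma integrable_exp_neg_mul_sq_prod {k : ℝ} (hk : 0 < k) :
    Integrable fun u : ℝ × ℝ => exp (-k * u.1 ^ 2) * exp (-k * u.2 ^ 2) :=
  (integrable_exp_neg_mul_sq hk).mul_prod (integrable_exp_neg_mul_sq hk)

/-- The Gaussian integral of a positive definite binary quadratic form. -/
lemma integral_exp_neg_quadratic {a b c : ℝ} (hc : 0 < c) (hd : 0 < a * c - b ^ 2)
    (hf_int : Integrable fun u : ℝ × ℝ =>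
      exp (-(a * u.1 ^ 2 + 2 * b * u.1 * u.2 + c * u.2 ^ 2))) :
    ∫ u : ℝ × ℝ, exp (-(a * u.1 ^ 2 + 2 * b * u.1 * u.2 + c * u.2 ^ 2)) =
      π / √(a * c - b ^ 2) := by
  have hin (s : ℝ) : ∫ t : ℝ, exp (-(a * s ^ 2 + 2 * b * s * t + c * t ^ 2)) =
      exp (-((a * c - b ^ 2) / c) * s ^ 2) * √(π / c) := by
    rw [← integral_gaussian, ← integral_const_mul,
      ← integral_add_right_eq_self (fun t => exp (-((a * c - b ^ 2) / c) * s ^ 2) * exp (-c * t ^ 2))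
        (b * s / c)]
    congr 1 with t
    rw [← exp_add]
    congr 1
    field_simp
    ring
  rw [Measure.volume_eq_prod, integral_prod _ hf_int]
  simp only [hin]
  rw [integral_mul_const, integral_gaussian, ← sqrt_mul (by positivity),
    show π / ((a * c - b ^ 2) / c) * (π / c) = π ^ 2 / (a * c - b ^ 2) by field_simp,
    sqrt_div (by positivity), sqrt_sq pi_pos.le]

/-- The Gram determinant of the two columns of a linear map `ℝ² → ℝ⁴`. -/
noncomputable def gramDet (A : ℝ × ℝ →L[ℝ] (Fin 4 → ℝ)) : ℝ :=
  (∑ i, A (1, 0) i ^ 2) * (∑ i, A (0, 1) i ^ 2) - (∑ i, A (1, 0) i * A (0, 1) i) ^ 2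

lemma map_prod_eq_smul_add_smul (A : ℝ × ℝ →L[ℝ] (Fin 4 → ℝ)) (u : ℝ × ℝ) :
    A u = u.1 • A (1, 0) + u.2 • A (0, 1) := by
  rw [← map_smul, ← map_smul, ← map_add]
  simp

lemma sum_sq_pos {v : Fin 4 → ℝ} (hv : v ≠ 0) : 0 < ∑ i, v i ^ 2 := by
  obtain ⟨i, hi⟩ := Function.ne_iff.1 hv
  exact Finset.sum_pos' (fun _ _ => sq_nonneg _) ⟨i, Finset.mem_univ _, sq_pos_of_ne_zero hi⟩

lemma norm_sq_le_sum_sq (v : Fin 4 → ℝ) : ‖v‖ ^ 2 ≤ ∑ i, v i ^ 2 := by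
  have h : ‖v‖ ≤ √(∑ i, v i ^ 2) := by
    refine (pi_norm_le_iff_of_nonneg (sqrt_nonneg _)).2 fun i => ?_
    rw [norm_eq_abs, ← sqrt_sq_eq_abs]
    exact sqrt_le_sqrt (Finset.single_le_sum (f := fun i => v i ^ 2)
      (fun _ _ => sq_nonneg _) (Finset.mem_univ i))
  exact (pow_le_pow_left₀ (norm_nonneg _) h 2).trans_eq
    (sq_sqrt (Finset.sum_nonneg fun _ _ => sq_nonneg _))

lemma sum_sq_map (A : ℝ × ℝ →L[ℝ] (Fin 4 → ℝ)) (u : ℝ × ℝ) :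
    ∑ i, A u i ^ 2 = (∑ i, A (1, 0) i ^ 2) * u.1 ^ 2 +
      2 * (∑ i, A (1, 0) i * A (0, 1) i) * u.1 * u.2 + (∑ i, A (0, 1) i ^ 2) * u.2 ^ 2 := by
  rw [map_prod_eq_smul_add_smul A u]
  simp only [Pi.add_apply, Pi.smul_apply, smul_eq_mul, Fin.sum_univ_four]
  ring

lemma gramDet_pos {A : ℝ × ℝ →L[ℝ] (Fin 4 → ℝ)} (hA : Function.Injective A) : 0 < gramDet A := by
  have hne {u : ℝ × ℝ} (hu : u ≠ 0) : A u ≠ 0 := (map_ne_zero_iff A hA).2 hu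
  have hq : 0 < ∑ i, A (0, 1) i ^ 2 := sum_sq_pos (hne (by simp))
  have h := sum_sq_pos (hne (u := (∑ i, A (0, 1) i ^ 2, -∑ i, A (1, 0) i * A (0, 1) i))
    fun h => hq.ne' (congrArg Prod.fst h))
  rw [sum_sq_map] at h
  refine pos_of_mul_pos_right (a := ∑ i, A (0, 1) i ^ 2) ?_ hq.le
  unfold gramDet
  linarith

lemma exp_neg_mul_norm_sq_le (c : ℝ) (u : ℝ × ℝ) :
    exp (-(c ^ 2 * ‖u‖ ^ 2) / 8) ≤ exp (-(c ^ 2 / 16) * u.1 ^ 2) * exp (-(c ^ 2 / 16) * u.2 ^ 2) := by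
  rw [← exp_add, exp_le_exp]
  have h1 : u.1 ^ 2 ≤ ‖u‖ ^ 2 := sq_le_sq' (neg_le_of_abs_le (norm_fst_le u))
    (le_of_abs_le (norm_fst_le u))
  have h2 : u.2 ^ 2 ≤ ‖u‖ ^ 2 := sq_le_sq' (neg_le_of_abs_le (norm_snd_le u))
    (le_of_abs_le (norm_snd_le u))
  nlinarith [mul_le_mul_of_nonneg_left h1 (sq_nonneg c), mul_le_mul_of_nonneg_left h2 (sq_nonneg c)]

lemma integral_exp_neg_sum_sq_map {A : ℝ × ℝ →L[ℝ] (Fin 4 → ℝ)} (hA : Function.Injective A) :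
    ∫ u : ℝ × ℝ, exp (-(∑ i, A u i ^ 2) / 8) = 8 * π / √(gramDet A) := by
  obtain ⟨L, hL⟩ := A.exists_leftInverse_of_injective_pi hA
  have hlow (u : ℝ × ℝ) : (1 / (‖L‖ + 1)) ^ 2 * ‖u‖ ^ 2 ≤ ∑ i, A u i ^ 2 := by
    refine le_trans ?_ (norm_sq_le_sum_sq _)
    rw [← mul_pow]
    gcongr
    rw [div_mul_eq_mul_div, one_mul, div_le_iff₀ (by positivity)]
    calc ‖u‖ = ‖L (A u)‖ := by rw [← ContinuousLinearMap.comp_apply, hL]; rfl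
      _ ≤ ‖L‖ * ‖A u‖ := L.le_opNorm _
      _ ≤ ‖A u‖ * (‖L‖ + 1) := by linarith [norm_nonneg (A u)]
  have hf_int : Integrable fun u : ℝ × ℝ => exp (-(∑ i, A u i ^ 2) / 8) := by
    refine (integrable_exp_neg_mul_sq_prod (k := (1 / (‖L‖ + 1)) ^ 2 / 16) (by positivity)).mono'
      (by fun_prop) (ae_of_all _ fun u => ?_)
    rw [norm_of_nonneg (exp_pos _).le]
    refine le_trans (exp_le_exp.2 ?_) (exp_neg_mul_norm_sq_le _ u)
    linarith [hlow u]
  have hform (u : ℝ × ℝ) : -(∑ i, A u i ^ 2) / 8 = -((∑ i, A (1, 0) i ^ 2) / 8 * u.1 ^ 2 +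
      2 * ((∑ i, A (1, 0) i * A (0, 1) i) / 8) * u.1 * u.2 +
      (∑ i, A (0, 1) i ^ 2) / 8 * u.2 ^ 2) := by
    rw [sum_sq_map]; ring
  have hg : (∑ i, A (1, 0) i ^ 2) / 8 * ((∑ i, A (0, 1) i ^ 2) / 8) -
      ((∑ i, A (1, 0) i * A (0, 1) i) / 8) ^ 2 = gramDet A / 8 ^ 2 := by
    unfold gramDet; ring
  have hpos := gramDet_pos hA
  have hq : 0 < ∑ i, A (0, 1) i ^ 2 := sum_sq_pos ((map_ne_zero_iff A hA).2 (by simp))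
  simp only [hform] at hf_int ⊢
  rw [integral_exp_neg_quadratic (by positivity) (by rw [hg]; positivity) hf_int, hg,
    sqrt_div hpos.le, sqrt_sq (by norm_num)]
  field_simp

/-- The rescaled inner integrand, concentrating at `x` as `κ → ∞`. -/
noncomputable def rescaledKernel (σ : ℝ × ℝ → Fin 4 → ℝ) (f : ℝ × ℝ → ℝ) (κ : ℝ)
    (x u : ℝ × ℝ) : ℝ :=
  Isq.indicator (fun y => exp (-κ ^ 2 * (∑ i, (σ x i - σ y i) ^ 2) / 8) * f y) (x + κ⁻¹ • u)

lemma integral_rescaledKernel (σ : ℝ × ℝ → Fin 4 → ℝ) (f : ℝ × ℝ → ℝ) (κ : ℝ) (x : ℝ × ℝ) :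
    ∫ u, rescaledKernel σ f κ x u =
      κ ^ 2 * ∫ y in Isq, exp (-κ ^ 2 * (∑ i, (σ x i - σ y i) ^ 2) / 8) * f y := by
  unfold rescaledKernel
  rw [Measure.integral_comp_smul volume (fun u => Isq.indicator
    (fun y => exp (-κ ^ 2 * (∑ i, (σ x i - σ y i) ^ 2) / 8) * f y) (x + u)) κ⁻¹,
    integral_add_left_eq_self (Isq.indicator
    (fun y => exp (-κ ^ 2 * (∑ i, (σ x i - σ y i) ^ 2) / 8) * f y)),
    integral_indicator measurableSet_Isq]
  simp

lemma norm_rescaledKernel_le {σ : ℝ × ℝ → Fin 4 → ℝ} {f : ℝ × ℝ → ℝ} {c M : ℝ} (hc : 0 < c)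
    (hσ : ∀ x ∈ Isq, ∀ y ∈ Isq, c * ‖x - y‖ ≤ ‖σ x - σ y‖) (hf : ∀ x ∈ Isq, |f x| ≤ M)
    {κ : ℝ} (hκ : 0 < κ) {x : ℝ × ℝ} (hx : x ∈ Isq) (u : ℝ × ℝ) :
    ‖rescaledKernel σ f κ x u‖ ≤
      exp (-(c ^ 2 / 16) * u.1 ^ 2) * exp (-(c ^ 2 / 16) * u.2 ^ 2) * M := by
  have hM : 0 ≤ M := (abs_nonneg _).trans (hf x hx)
  unfold rescaledKernel
  by_cases hy : x + κ⁻¹ • u ∈ Isq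
  · rw [Set.indicator_of_mem hy, norm_mul, norm_of_nonneg (exp_pos _).le]
    refine mul_le_mul ?_ (hf _ hy) (norm_nonneg _) (by positivity)
    refine le_trans (exp_le_exp.2 ?_) (exp_neg_mul_norm_sq_le c u)
    have h1 : c * (κ⁻¹ * ‖u‖) ≤ ‖σ x - σ (x + κ⁻¹ • u)‖ := by
      simpa [norm_smul, abs_of_pos hκ] using hσ x hx _ hy
    have h2 := (pow_le_pow_left₀ (by positivity) h1 2).trans (norm_sq_le_sum_sq _)
    have h3 := mul_le_mul_of_nonneg_left h2 (sq_nonneg κ)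
    have h4 : κ ^ 2 * (c * (κ⁻¹ * ‖u‖)) ^ 2 = c ^ 2 * ‖u‖ ^ 2 := by field_simp
    simp only [Pi.sub_apply] at h3
    linarith
  · rw [Set.indicator_of_notMem hy, norm_zero]
    positivity

lemma tendsto_rescaledKernel {σ : ℝ × ℝ → Fin 4 → ℝ} {f : ℝ × ℝ → ℝ} {x : ℝ × ℝ}
    (hσ : DifferentiableAt ℝ σ x) (hf : ContinuousAt f x) (hx : Isq ∈ nhds x) (u : ℝ × ℝ) :
    Tendsto (fun κ => rescaledKernel σ f κ x u) atTop
      (nhds (exp (-(∑ i, fderiv ℝ σ x u i ^ 2) / 8) * f x)) := by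
  have hy : Tendsto (fun κ : ℝ => x + κ⁻¹ • u) atTop (nhds x) := by
    simpa using tendsto_const_nhds.add ((tendsto_inv_atTop_zero (𝕜 := ℝ)).smul_const u)
  have hd : Tendsto (fun κ : ℝ => κ • (σ (x + κ⁻¹ • u) - σ x)) atTop (nhds (fderiv ℝ σ x u)) :=
    hσ.hasFDerivAt.lim u tendsto_norm_atTop_atTop
  have hs : Tendsto (fun κ : ℝ => exp (-(∑ i, (κ • (σ (x + κ⁻¹ • u) - σ x)) i ^ 2) / 8) *
      f (x + κ⁻¹ • u)) atTop (nhds (exp (-(∑ i, fderiv ℝ σ x u i ^ 2) / 8) * f x)) := by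
    refine Tendsto.mul ((continuous_exp.tendsto _).comp (Tendsto.div_const (Tendsto.neg ?_) _))
      (hf.tendsto.comp hy)
    exact tendsto_finsetSum _ fun i _ => ((tendsto_pi_nhds.1 hd) i).pow 2
  refine hs.congr' ?_
  filter_upwards [hy hx] with κ hκ
  unfold rescaledKernel
  rw [Set.indicator_of_mem (Set.mem_preimage.1 hκ)]
  congr 3
  rw [neg_mul, Finset.mul_sum]
  congr 2 with i
  simp only [Pi.smul_apply, Pi.sub_apply, smul_eq_mul]
  ring

lemma measurable_rescaledKernel {σ : ℝ × ℝ → Fin 4 → ℝ} {f : ℝ × ℝ → ℝ} (hσ : Continuous σ)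
    (hf : Continuous f) (κ : ℝ) :
    Measurable fun z : (ℝ × ℝ) × (ℝ × ℝ) => rescaledKernel σ f κ z.1 z.2 := by
  have h : (fun z : (ℝ × ℝ) × (ℝ × ℝ) => rescaledKernel σ f κ z.1 z.2) =
      ((fun z : (ℝ × ℝ) × (ℝ × ℝ) => z.1 + κ⁻¹ • z.2) ⁻¹' Isq).indicator (fun z =>
        exp (-κ ^ 2 * (∑ i, (σ z.1 i - σ (z.1 + κ⁻¹ • z.2) i) ^ 2) / 8) * f (z.1 + κ⁻¹ • z.2)) := rfl
  rw [h]
  refine Measurable.indicator (Continuous.measurable (by fun_prop)) ?_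
  exact (by fun_prop : Continuous fun z : (ℝ × ℝ) × (ℝ × ℝ) => z.1 + κ⁻¹ • z.2).measurable
    measurableSet_Isq

lemma tendsto_gaussian_double_integral {σ : ℝ × ℝ → Fin 4 → ℝ} {f : ℝ × ℝ → ℝ}
    (hσ : ContDiff ℝ 1 σ) (hinj : Set.InjOn σ Isq)
    (himm : ∀ q ∈ Isq, Function.Injective (fderiv ℝ σ q)) (hf : Continuous f) :
    Tendsto (fun κ : ℝ => κ ^ 2 / 4 * ∫ x in Isq, ∫ y in Isq,
        exp (-κ ^ 2 * (∑ i, (σ x i - σ y i) ^ 2) / 8) * f x * f y) atTop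
      (nhds (2 * π * ∫ x in Isq, f x ^ 2 / √(gramDet (fderiv ℝ σ x)))) := by
  obtain ⟨c, hc, hlow⟩ :=
    exists_pos_mul_dist_le_of_injOn_immersion hσ isCompact_Isq hinj himm
  obtain ⟨M, hM⟩ := isCompact_Isq.exists_bound_of_continuousOn hf.continuousOn
  have hB := (integrable_exp_neg_mul_sq_prod (k := c ^ 2 / 16) (by positivity)).mul_const M
  have hmeas := measurable_rescaledKernel hσ.continuous hf
  have hinner : ∀ x ∈ Isq, Isq ∈ nhds x → Tendsto (fun κ => ∫ u, rescaledKernel σ f κ x u) atTop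
      (nhds (8 * π / √(gramDet (fderiv ℝ σ x)) * f x)) := by
    intro x hxI hx
    rw [← integral_exp_neg_sum_sq_map (himm x hxI), ← integral_mul_const]
    refine tendsto_integral_filter_of_dominated_convergence _ (.of_forall fun κ => ?_) ?_ hB ?_
    · exact ((hmeas κ).comp measurable_prodMk_left).aestronglyMeasurable
    · filter_upwards [eventually_gt_atTop 0] with κ hκ
      exact ae_of_all _ (norm_rescaledKernel_le hc hlow hM hκ hxI)
    · exact ae_of_all _ (tendsto_rescaledKernel (hσ.differentiable one_ne_zero x)
        hf.continuousAt hx)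
  have houter : Tendsto (fun κ : ℝ => ∫ x in Isq, f x * ∫ u, rescaledKernel σ f κ x u) atTop
      (nhds (∫ x in Isq, f x * (8 * π / √(gramDet (fderiv ℝ σ x)) * f x))) := by
    refine tendsto_integral_filter_of_dominated_convergence
      (fun _ => M * ∫ u : ℝ × ℝ, exp (-(c ^ 2 / 16) * u.1 ^ 2) * exp (-(c ^ 2 / 16) * u.2 ^ 2) * M)
      (.of_forall fun κ => ?_) ?_ ?_ ?_
    · exact hf.aestronglyMeasurable.mul
        (hmeas κ).stronglyMeasurable.integral_prod_right.aestronglyMeasurable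
    · filter_upwards [eventually_gt_atTop 0] with κ hκ
      filter_upwards [ae_restrict_mem measurableSet_Isq] with x hx
      rw [norm_mul]
      exact mul_le_mul (hM x hx) (norm_integral_le_of_norm_le hB
        (ae_of_all _ (norm_rescaledKernel_le hc hlow hM hκ hx))) (norm_nonneg _)
        ((norm_nonneg _).trans (hM x hx))
    · exact integrableOn_const isCompact_Isq.measure_lt_top.ne
    · filter_upwards [ae_restrict_mem measurableSet_Isq, Isq_ae_mem_interior] with x hxI hx
      exact (hinner x hxI hx).const_mul _
  have hlim : 2 * π * ∫ x in Isq, f x ^ 2 / √(gramDet (fderiv ℝ σ x)) =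
      1 / 4 * ∫ x in Isq, f x * (8 * π / √(gramDet (fderiv ℝ σ x)) * f x) := by
    rw [← integral_const_mul, ← integral_const_mul]
    congr 1 with x
    ring
  rw [hlim]
  refine (houter.const_mul (1 / 4)).congr fun κ => ?_
  rw [← integral_const_mul, ← integral_const_mul]
  congr 1 with x
  rw [integral_rescaledKernel, ← integral_const_mul, ← integral_const_mul, ← integral_const_mul,
    ← integral_const_mul]
  congr 1 with y
  ring

lemma det_Jmat (σ : ℝ × ℝ → Fin 4 → ℝ) (a b : Fin 4) (q : ℝ × ℝ) :
    (Jmat σ a b q).det = fderiv ℝ σ q (1, 0) a * fderiv ℝ σ q (0, 1) b -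
      fderiv ℝ σ q (0, 1) a * fderiv ℝ σ q (1, 0) b := by
  simp [Jmat, det_fin_two]

lemma det_transpose_mul_Jmat_add (σ : ℝ × ℝ → Fin 4 → ℝ) {i : Fin 4 × Fin 4 × Fin 4 × Fin 4}
    (hi : i ∈ quads) (q : ℝ × ℝ) :
    ((Jmat σ i.1 i.2.1 q)ᵀ * Jmat σ i.1 i.2.1 q +
      (Jmat σ i.2.2.1 i.2.2.2 q)ᵀ * Jmat σ i.2.2.1 i.2.2.2 q).det = gramDet (fderiv ℝ σ q) := by
  simp only [quads, List.mem_cons, List.not_mem_nil, or_false] at hi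
  rcases hi with rfl | rfl | rfl | rfl | rfl | rfl <;>
  · simp only [Jmat, gramDet, det_fin_two, Matrix.add_apply, Matrix.mul_apply,
      Matrix.transpose_apply, Fin.sum_univ_two, Fin.sum_univ_four, Matrix.of_apply,
      Matrix.cons_val_zero, Matrix.cons_val_one]
    ring

lemma continuous_det_Jmat {σ : ℝ × ℝ → Fin 4 → ℝ} (hσ : ContDiff ℝ 1 σ) (a b : Fin 4) :
    Continuous fun q => (Jmat σ a b q).det := by
  have h (v : ℝ × ℝ) (a : Fin 4) : Continuous fun q => fderiv ℝ σ q v a :=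
    (continuous_apply a).comp ((hσ.continuous_fderiv one_ne_zero).clm_apply continuous_const)
  simp only [det_Jmat]
  exact ((h _ _).mul (h _ _)).sub ((h _ _).mul (h _ _))

lemma rhoIntegral_eq (σ : ℝ × ℝ → Fin 4 → ℝ) :
    rhoIntegral σ = (quads.map fun i =>
      ∫ q in Isq, (Jmat σ i.1 i.2.1 q).det ^ 2 / √(gramDet (fderiv ℝ σ q))).sum := by
  unfold rhoIntegral
  congr 1
  refine List.map_congr_left fun i hi => ?_
  simp only [det_transpose_mul_Jmat_add σ hi]

lemma ContinuousLinearMap.det_prod_eq (P : ℝ × ℝ →L[ℝ] ℝ × ℝ) :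
    P.det = (P (1, 0)).1 * (P (0, 1)).2 - (P (0, 1)).1 * (P (1, 0)).2 := by
  rw [ContinuousLinearMap.det, ← LinearMap.det_toMatrix (Module.Basis.finTwoProd ℝ), det_fin_two]
  simp [LinearMap.toMatrix_apply]

/-- Two injective immersions of the square with the same image differ by a reparametrization. -/
lemma exists_reparametrization {σ τ : ℝ × ℝ → Fin 4 → ℝ} (hσ : ContDiff ℝ 1 σ)
    (hσinj : Set.InjOn σ Isq) (hτ : ContDiff ℝ 1 τ) (hτinj : Set.InjOn τ Isq)
    (hτimm : ∀ q ∈ Isq, Function.Injective (fderiv ℝ τ q)) (him : σ '' Isq = τ '' Isq) :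
    ∃ (φ : ℝ × ℝ → ℝ × ℝ) (P : ℝ × ℝ → ℝ × ℝ →L[ℝ] ℝ × ℝ), φ '' Isq = Isq ∧ Set.InjOn φ Isq ∧
      (∀ q ∈ Isq, HasFDerivWithinAt φ (P q) Isq q) ∧
      ∀ q ∈ Isq, fderiv ℝ σ q = (fderiv ℝ τ (φ q)).comp (P q) := by
  have hex : ∀ q : ℝ × ℝ, ∃ p, q ∈ Isq → p ∈ Isq ∧ τ p = σ q := fun q => by
    by_cases hq : q ∈ Isq
    · obtain ⟨p, hp, h⟩ := him ▸ Set.mem_image_of_mem σ hq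
      exact ⟨p, fun _ => ⟨hp, h⟩⟩
    · exact ⟨0, fun h => absurd h hq⟩
  choose φ hφ using hex
  have hφI : ∀ q ∈ Isq, φ q ∈ Isq := fun q hq => (hφ q hq).1
  have hφσ : ∀ q ∈ Isq, τ (φ q) = σ q := fun q hq => (hφ q hq).2
  obtain ⟨c, hc, hlow⟩ :=
    exists_pos_mul_dist_le_of_injOn_immersion hτ isCompact_Isq hτinj hτimm
  have hcont : ContinuousOn φ Isq := by
    intro q hq
    refine tendsto_iff_norm_sub_tendsto_zero.2 (squeeze_zero' (g := fun x => c⁻¹ * ‖σ x - σ q‖)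
      (.of_forall fun _ => norm_nonneg _) ?_ ?_)
    · filter_upwards [self_mem_nhdsWithin] with x hx
      rw [le_inv_mul_iff₀ hc, ← hφσ x hx, ← hφσ q hq]
      exact hlow _ (hφI x hx) _ (hφI q hq)
    · have : Continuous fun x => c⁻¹ * ‖σ x - σ q‖ := by
        have := hσ.continuous
        fun_prop
      simpa using (this.tendsto q).mono_left nhdsWithin_le_nhds
  have hder : ∀ q, ∃ P : ℝ × ℝ →L[ℝ] ℝ × ℝ, q ∈ Isq → HasFDerivWithinAt φ P Isq q := by
    intro q
    by_cases hq : q ∈ Isq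
    swap
    · exact ⟨0, fun h => absurd h hq⟩
    obtain ⟨L, hL⟩ :=
      (fderiv ℝ τ (φ q)).exists_leftInverse_of_injective_pi (hτimm _ (hφI q hq))
    have hs : HasStrictFDerivAt (fun z => L (τ z))
        ((ContinuousLinearEquiv.refl ℝ (ℝ × ℝ) : (ℝ × ℝ) ≃L[ℝ] (ℝ × ℝ)) :
          ℝ × ℝ →L[ℝ] ℝ × ℝ) (φ q) := by
      rw [ContinuousLinearEquiv.coe_refl, ← hL]
      exact L.hasStrictFDerivAt.comp (φ q) (hτ.contDiffAt.hasStrictFDerivAt one_ne_zero)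
    have hinv := hs.to_localInverse.hasFDerivAt
    simp only [hφσ q hq] at hinv
    have hcomp := hinv.comp q (L.hasFDerivAt.comp q (hσ.differentiable one_ne_zero q).hasFDerivAt)
    refine ⟨_, fun _ => hcomp.hasFDerivWithinAt.congr_of_eventuallyEq ?_ ?_⟩
    · filter_upwards [(hcont q hq).eventually hs.eventually_left_inverse, self_mem_nhdsWithin]
        with x hx hxI
      rw [hφσ x hxI] at hx
      exact hx.symm
    · have hx := hs.eventually_left_inverse.self_of_nhds
      rw [hφσ q hq] at hx
      exact hx.symm
  choose P hP using hder
  refine ⟨φ, P, ?_, ?_, hP, ?_⟩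
  · refine Set.Subset.antisymm (Set.image_subset_iff.2 hφI) fun p hp => ?_
    obtain ⟨q, hq, h⟩ := him.symm ▸ Set.mem_image_of_mem τ hp
    exact ⟨q, hq, hτinj (hφI q hq) hp ((hφσ q hq).trans h)⟩
  · intro x hx y hy h
    exact hσinj hx hy (by rw [← hφσ x hx, ← hφσ y hy, h])
  · intro q hq
    refine (uniqueDiffOn_Isq q hq).eq
      (hσ.differentiable one_ne_zero q).hasFDerivAt.hasFDerivWithinAt ?_
    exact ((hτ.differentiable one_ne_zero (φ q)).hasFDerivAt.comp_hasFDerivWithinAt q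
      (hP q hq)).congr (fun x hx => (hφσ x hx).symm) (hφσ q hq).symm

lemma gramDet_comp (A : ℝ × ℝ →L[ℝ] (Fin 4 → ℝ)) (P : ℝ × ℝ →L[ℝ] ℝ × ℝ) :
    gramDet (A.comp P) = P.det ^ 2 * gramDet A := by
  rw [P.det_prod_eq]
  unfold gramDet
  simp only [ContinuousLinearMap.comp_apply, map_prod_eq_smul_add_smul A (P _), Pi.add_apply,
    Pi.smul_apply, smul_eq_mul, Fin.sum_univ_four]
  ring

lemma det_Jmat_of_fderiv_eq_comp {σ τ : ℝ × ℝ → Fin 4 → ℝ} {q p : ℝ × ℝ}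
    {P : ℝ × ℝ →L[ℝ] ℝ × ℝ} (h : fderiv ℝ σ q = (fderiv ℝ τ p).comp P) (a b : Fin 4) :
    (Jmat σ a b q).det = P.det * (Jmat τ a b p).det := by
  rw [P.det_prod_eq, det_Jmat, det_Jmat, h]
  simp only [ContinuousLinearMap.comp_apply, map_prod_eq_smul_add_smul _ (P _), Pi.add_apply,
    Pi.smul_apply, smul_eq_mul]
  ring

lemma rhoIntegral_eq_of_image_eq {σ τ : ℝ × ℝ → Fin 4 → ℝ} (hσ : ContDiff ℝ 1 σ)
    (hσinj : Set.InjOn σ Isq) (hτ : ContDiff ℝ 1 τ) (hτinj : Set.InjOn τ Isq)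
    (hτimm : ∀ q ∈ Isq, Function.Injective (fderiv ℝ τ q)) (him : σ '' Isq = τ '' Isq) :
    rhoIntegral σ = rhoIntegral τ := by
  obtain ⟨φ, P, hφ, hφinj, hP, hcomp⟩ := exists_reparametrization hσ hσinj hτ hτinj hτimm him
  rw [rhoIntegral_eq, rhoIntegral_eq]
  congr 1
  refine List.map_congr_left fun i _ => ?_
  conv_rhs => rw [← hφ, integral_image_eq_integral_abs_det_fderiv_smul volume measurableSet_Isq hP
    hφinj]
  refine setIntegral_congr_fun measurableSet_Isq fun q hq => ?_
  simp only [smul_eq_mul]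
  rw [det_Jmat_of_fderiv_eq_comp (hcomp q hq), hcomp q hq, gramDet_comp,
    sqrt_mul (sq_nonneg _), sqrt_sq_eq_abs, mul_pow, ← sq_abs (P q).det]
  rcases eq_or_ne |(P q).det| 0 with h0 | h0
  · simp [h0]
  · rw [sq |(P q).det|, mul_assoc, mul_div_mul_left _ _ h0, mul_div_assoc]

/-- For a smooth injective parametrization `σ` of a surface `S ⊆ ℝ⁴` with everywhere injective
differential, the Gaussian double integral converges to `2π ∫_S ρ_S` as `κ → ∞`, and the limit
`∫_S ρ_S` is independent of the parametrization of `S = σ([0,1]²)`. -/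
theorem stmt11 (σ : ℝ × ℝ → Fin 4 → ℝ) (hσ : ContDiff ℝ (⊤ : ℕ∞) σ)
    (hinj : Set.InjOn σ Isq)
    (himm : ∀ q ∈ Isq, Function.Injective (fderiv ℝ σ q)) :
    Tendsto (fun κ : ℝ => doubleSum σ κ) atTop (nhds (2 * π * rhoIntegral σ)) ∧
    (∀ τ : ℝ × ℝ → Fin 4 → ℝ, ContDiff ℝ (⊤ : ℕ∞) τ → Set.InjOn τ Isq →
      (∀ q ∈ Isq, Function.Injective (fderiv ℝ τ q)) → σ '' Isq = τ '' Isq →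
      rhoIntegral σ = rhoIntegral τ) := by

  have h1 : (1 : WithTop ℕ∞) ≤ ((⊤ : ℕ∞) : WithTop ℕ∞) := by exact_mod_cast le_top
  refine ⟨?_, fun τ hτ hτinj hτimm him =>
    rhoIntegral_eq_of_image_eq (hσ.of_le h1) hinj (hτ.of_le h1) hτinj hτimm him⟩
  have key (i : Fin 4 × Fin 4 × Fin 4 × Fin 4) := tendsto_gaussian_double_integral
    (hσ.of_le h1) hinj himm (continuous_det_Jmat (hσ.of_le h1) i.1 i.2.1).abs
  simp only [sq_abs] at key
  rw [rhoIntegral_eq, ← List.sum_map_mul_left]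
  exact tendsto_list_sum quads fun i _ => key i
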